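/- arXiv:math/0311299 — 3 statements merged into one kernel-verified Lean document; each statement's English description precedes it below -/
import Mathlib

section
/- Let h : ℂ → ℂ be entire and nowhere vanishing. Then for every real r > 0, ∫ ρ in (0)..(r), ((2/π) * ∫ z in Metric.ball (0:ℂ) ρ, ‖deriv h z‖^2 / (1 + ‖h z‖^2)^2 ∂(volume)) / ρ dρ = (1/(2*π)) * ∫ θ in (0)..(2*π), Real.log (‖h (r * Complex.exp (θ * Complex.I))‖ + ‖h (r * Complex.exp (θ * Complex.I))‖⁻¹) dθ + Real.log ‖h 0‖ − Real.log (1 + ‖h 0‖^2). -/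
open MeasureTheory

namespace ASAux

noncomputable def E (ρ θ : ℝ) : ℂ := (ρ : ℂ) * Complex.exp ((θ : ℂ) * Complex.I)

noncomputable def F (h : ℂ → ℂ) (z : ℂ) : ℝ := ‖deriv h z‖ ^ 2 / (1 + ‖h z‖ ^ 2) ^ 2

noncomputable def D (h : ℂ → ℂ) (z : ℂ) : ℂ := 1 + h z * star (h z)

noncomputable def P (h : ℂ → ℂ) (z : ℂ) : ℂ := deriv h z * star (h z) / D h z

noncomputable def A (h : ℂ → ℂ) (z : ℂ) : ℂ :=
  deriv (deriv h) z * star (h z) / D h z - (deriv h z) ^ 2 * star (h z) ^ 2 / D h z ^ 2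

lemma D_eq (h : ℂ → ℂ) (z : ℂ) : D h z = ((1 + ‖h z‖ ^ 2 : ℝ) : ℂ) := by
  unfold D
  have := Complex.mul_conj' (h z)
  push_cast
  rw [← this]; rfl

lemma D_ne (h : ℂ → ℂ) (z : ℂ) : D h z ≠ 0 := by
  rw [D_eq, Complex.ofReal_ne_zero]
  positivity

lemma F_eq (h : ℂ → ℂ) (z : ℂ) : (F h z : ℂ) = deriv h z * star (deriv h z) / D h z ^ 2 := by
  rw [D_eq]
  have := Complex.mul_conj' (deriv h z)
  unfold F
  push_cast
  rw [← this]; rfl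

variable {h : ℂ → ℂ}

lemma d1 (hd : Differentiable ℂ h) : Differentiable ℂ (deriv h) :=
  fun z => ((hd.analyticAt z).deriv).differentiableAt

lemma P_deriv (hd : Differentiable ℂ h) {γ : ℝ → ℂ} {γ' : ℂ} {t : ℝ} (hγ : HasDerivAt γ γ' t) :
    HasDerivAt (fun s => P h (γ s)) (A h (γ t) * γ' + F h (γ t) * star γ') t := by
  have h1 : HasDerivAt (fun s => h (γ s)) (deriv h (γ t) * γ') t :=
    (hd (γ t)).hasDerivAt.comp t hγ
  have h2 : HasDerivAt (fun s => deriv h (γ s)) (deriv (deriv h) (γ t) * γ') t :=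
    (d1 hd (γ t)).hasDerivAt.comp t hγ
  have h3 := h1.star
  have hD : HasDerivAt (fun s => D h (γ s)) _ t := (h1.mul h3).const_add 1
  have := (h2.mul h3).div hD (D_ne h (γ t))
  refine this.congr_deriv ?_
  rw [F_eq]
  unfold A
  have := D_ne h (γ t)
  simp only [star_mul']
  field_simp
  simp only [D, Pi.mul_apply]
  ring

lemma u_deriv (hd : Differentiable ℂ h) {γ : ℝ → ℂ} {γ' : ℂ} {t : ℝ} (hγ : HasDerivAt γ γ' t) :
    HasDerivAt (fun s => Real.log (1 + ‖h (γ s)‖ ^ 2)) (2 * (P h (γ t) * γ').re) t := by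
  have h1 : HasDerivAt (fun s => h (γ s)) (deriv h (γ t) * γ') t :=
    (hd (γ t)).hasDerivAt.comp t hγ
  have h2 := (h1.norm_sq.const_add 1).log (by positivity)
  refine h2.congr_deriv ?_
  unfold P
  rw [D_eq, div_mul_eq_mul_div, Complex.div_ofReal_re, Complex.inner, mul_div_assoc]
  congr 3
  simp
  ring

lemma E_rho (ρ θ : ℝ) : HasDerivAt (fun s => E s θ) (E 1 θ) ρ := by
  unfold E
  exact (Complex.ofRealCLM.hasDerivAt (x := ρ)).mul_const _

lemma E_theta (ρ θ : ℝ) : HasDerivAt (fun s => E ρ s) (Complex.I * E ρ θ) θ := by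
  unfold E
  have := (((Complex.ofRealCLM.hasDerivAt (x := θ)).mul_const Complex.I).cexp).const_mul (ρ : ℂ)
  refine this.congr_deriv ?_
  simp
  ring

lemma E_cont : Continuous (fun p : ℝ × ℝ => E p.1 p.2) := by unfold E; fun_prop

lemma E_eq (ρ θ : ℝ) : E ρ θ = ρ * E 1 θ := by simp [E]

lemma E_star (θ : ℝ) : E 1 θ * star (E 1 θ) = 1 := by
  have := Complex.mul_conj' (E 1 θ)
  simp only [← Complex.star_def] at this
  rw [this]
  simp [E, Complex.norm_exp_ofReal_mul_I]

noncomputable def v (h : ℂ → ℂ) (ρ θ : ℝ) : ℂ := P h (E ρ θ) * E 1 θ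

noncomputable def vθ (h : ℂ → ℂ) (ρ θ : ℝ) : ℂ :=
  (A h (E ρ θ) * (Complex.I * E ρ θ) + F h (E ρ θ) * star (Complex.I * E ρ θ)) * E 1 θ +
    P h (E ρ θ) * (Complex.I * E 1 θ)

lemma v_theta (hd : Differentiable ℂ h) (ρ θ : ℝ) : HasDerivAt (fun s => v h ρ s) (vθ h ρ θ) θ :=
  (P_deriv hd (E_theta ρ θ)).mul (E_theta 1 θ)

lemma v_rho (hd : Differentiable ℂ h) (ρ θ : ℝ) :
    HasDerivAt (fun s : ℝ => (s : ℂ) * v h s θ)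
      ((2 * ρ * F h (E ρ θ) : ℝ) - Complex.I * vθ h ρ θ) ρ := by
  have := (Complex.ofRealCLM.hasDerivAt (x := ρ)).mul ((P_deriv hd (E_rho ρ θ)).mul_const (E 1 θ))
  refine this.congr_deriv ?_
  unfold vθ
  simp only [star_mul', Complex.ofRealCLM_apply, E_eq ρ θ]
  have h1 := E_star θ
  have h2 := Complex.I_sq
  simp only [Complex.star_def, Complex.conj_I, Complex.conj_ofReal, Complex.ofReal_one, 
    Complex.ofReal_mul, Complex.ofReal_ofNat] at *
  generalize (starRingEnd ℂ) (E 1 θ) = e' at *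
  generalize E 1 θ = e at *
  generalize A h _ = a 
  generalize P h _ = b 
  generalize (F h _ : ℂ) = f
  linear_combination (2 * ρ * f) * h1 + (ρ*a*e^2 - ρ * f * (e * e') + b * e) * h2

lemma F_cont (hd : Differentiable ℂ h) : Continuous (F h) := by
  have := (d1 hd).continuous
  have := hd.continuous
  unfold F
  refine Continuous.div (by fun_prop) (by fun_prop) (fun z => by positivity)

lemma D_cont (hd : Differentiable ℂ h) : Continuous (D h) := by
  have := hd.continuous
  unfold D
  fun_prop

lemma P_cont (hd : Differentiable ℂ h) : Continuous (P h) := by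
  have := (d1 hd).continuous
  have := hd.continuous
  unfold P
  exact Continuous.div (by fun_prop) (D_cont hd) (D_ne h)

lemma A_cont (hd : Differentiable ℂ h) : Continuous (A h) := by
  have := (d1 (d1 hd)).continuous
  have := (d1 hd).continuous
  have := hd.continuous
  have := D_cont hd
  unfold A
  exact (Continuous.div (by fun_prop) (D_cont hd) (D_ne h)).sub
    (Continuous.div (by fun_prop) (by fun_prop) (fun z => pow_ne_zero _ (D_ne h z)))

lemma E1_cont : Continuous (fun p : ℝ × ℝ => E 1 p.2) := by unfold E; fun_prop

lemma v_cont (hd : Differentiable ℂ h) : Continuous (fun p : ℝ × ℝ => v h p.1 p.2) :=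
  ((P_cont hd).comp E_cont).mul E1_cont

lemma vθ_cont (hd : Differentiable ℂ h) : Continuous (fun p : ℝ × ℝ => vθ h p.1 p.2) := by
  have h1 := (A_cont hd).comp E_cont
  have h2 := (P_cont hd).comp E_cont
  have h3 := Complex.continuous_ofReal.comp ((F_cont hd).comp E_cont)
  have h4 := E_cont
  have h5 := E1_cont
  simp only [Function.comp_def] at h1 h2 h3
  unfold vθ
  fun_prop

lemma swap {G : Type*} [NormedAddCommGroup G] [NormedSpace ℝ G] {f : ℝ → ℝ → G}
    (hf : Continuous (fun p : ℝ × ℝ => f p.1 p.2)) (a b c d : ℝ) :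
    ∫ x in a..b, ∫ y in c..d, f x y = ∫ y in c..d, ∫ x in a..b, f x y := by
  apply MeasureTheory.intervalIntegral_intervalIntegral_swap
  refine (hf.continuousOn.integrableOn_compact (isCompact_uIcc.prod isCompact_uIcc)).mono_set
    (Set.prod_mono Set.uIoc_subset_uIcc Set.uIoc_subset_uIcc)

lemma slice1 {G : Type*} [TopologicalSpace G] {f : ℝ → ℝ → G}
    (hf : Continuous (fun p : ℝ × ℝ => f p.1 p.2)) (x : ℝ) : Continuous (fun y => f x y) :=
  hf.comp (by fun_prop : Continuous fun y : ℝ => (x, y))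

lemma slice2 {G : Type*} [TopologicalSpace G] {f : ℝ → ℝ → G}
    (hf : Continuous (fun p : ℝ × ℝ => f p.1 p.2)) (y : ℝ) : Continuous (fun x => f x y) :=
  hf.comp (by fun_prop : Continuous fun x : ℝ => (x, y))

lemma polar (hd : Differentiable ℂ h) {ρ : ℝ} (hρ : 0 ≤ ρ) :
    ∫ z in Metric.ball (0:ℂ) ρ, F h z =
      ∫ s in (0:ℝ)..ρ, ∫ θ in (-Real.pi)..Real.pi, s * F h (E s θ) := by
  rw [← integral_indicator Metric.isOpen_ball.measurableSet,
    ← Complex.integral_comp_polarCoord_symm]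
  have hc : Continuous (fun p : ℝ × ℝ => p.1 * F h (E p.1 p.2)) :=
    continuous_fst.mul ((F_cont hd).comp E_cont)
  have e1 : ∀ p ∈ polarCoord.target, p.1 • (Metric.ball (0:ℂ) ρ).indicator (F h)
      (Complex.polarCoord.symm p) =
      (Set.Iio ρ ×ˢ Set.univ).indicator (fun p : ℝ × ℝ => p.1 * F h (E p.1 p.2)) p := by
    rintro ⟨s, θ⟩ hp
    have hs : 0 < s := hp.1
    have : Complex.polarCoord.symm (s, θ) = E s θ := by
      simp [Complex.polarCoord_symm_apply, E, Complex.exp_mul_I]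
    have hn : ‖E s θ‖ = s := by simp [E, Complex.norm_exp_ofReal_mul_I, hs.le]
    rw [this]
    by_cases hsρ : s < ρ
    · rw [Set.indicator_of_mem (by simpa [hn] using hsρ), Set.indicator_of_mem (by simpa using hsρ)]
      rfl
    · rw [Set.indicator_of_notMem (by simpa [hn] using hsρ),
        Set.indicator_of_notMem (by simpa using hsρ)]
      simp
  rw [setIntegral_congr_fun polarCoord.open_target.measurableSet e1,
    setIntegral_indicator (measurableSet_Iio.prod MeasurableSet.univ)]
  have : polarCoord.target ∩ Set.Iio ρ ×ˢ Set.univ = Set.Ioo 0 ρ ×ˢ Set.Ioo (-Real.pi) Real.pi := by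
    ext ⟨s, θ⟩
    simp [polarCoord]
    tauto
  rw [this, Measure.volume_eq_prod, setIntegral_prod]
  · rw [intervalIntegral.integral_of_le hρ, integral_Ioc_eq_integral_Ioo]
    congr 1
    ext s
    rw [intervalIntegral.integral_of_le (by linarith [Real.pi_pos]), integral_Ioc_eq_integral_Ioo]
  · exact (hc.continuousOn.integrableOn_compact (isCompact_Icc.prod isCompact_Icc)).mono_set
      (Set.prod_mono Set.Ioo_subset_Icc_self Set.Ioo_subset_Icc_self)

lemma E_per (ρ θ : ℝ) : E ρ (θ + 2 * Real.pi) = E ρ θ := by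
  unfold E
  push_cast
  rw [add_mul, Complex.exp_add, Complex.exp_two_pi_mul_I, mul_one]

lemma area (hd : Differentiable ℂ h) {ρ : ℝ} (hρ : 0 ≤ ρ) :
    (ρ : ℂ) * ∫ θ in (-Real.pi)..Real.pi, v h ρ θ =
      ((2 * ∫ z in Metric.ball (0:ℂ) ρ, F h z : ℝ) : ℂ) := by
  have hvc := vθ_cont hd
  have hc1 : Continuous (fun p : ℝ × ℝ => ((2 * p.1 * F h (E p.1 p.2) : ℝ) : ℂ)) :=
    Complex.continuous_ofReal.comp
      ((continuous_const.mul continuous_fst).mul ((F_cont hd).comp E_cont))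
  have hc : Continuous (fun p : ℝ × ℝ =>
      ((2 * p.1 * F h (E p.1 p.2) : ℝ) : ℂ) - Complex.I * vθ h p.1 p.2) :=
    hc1.sub (continuous_const.mul hvc)
  have hx : ∀ θ : ℝ, (ρ : ℂ) * v h ρ θ =
      ∫ s in (0:ℝ)..ρ, (((2 * s * F h (E s θ) : ℝ) : ℂ) - Complex.I * vθ h s θ) := by
    intro θ
    rw [intervalIntegral.integral_eq_sub_of_hasDerivAt (fun s _ => v_rho hd s θ)]
    · simp
    · exact (slice2 (f := fun s θ => ((2 * s * F h (E s θ) : ℝ) : ℂ) - Complex.I * vθ h s θ)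
        hc θ).intervalIntegrable _ _
  rw [← intervalIntegral.integral_const_mul]
  simp_rw [hx]
  rw [← swap (f := fun s θ => ((2 * s * F h (E s θ) : ℝ) : ℂ) - Complex.I * vθ h s θ) hc,
    polar hd hρ, ← intervalIntegral.integral_const_mul, ← intervalIntegral.integral_ofReal]
  congr 1
  ext s
  have i1 : Continuous fun θ : ℝ => ((2 * s * F h (E s θ) : ℝ) : ℂ) :=
    slice1 (f := fun s θ => ((2 * s * F h (E s θ) : ℝ) : ℂ)) hc1 s
  have i2 : Continuous fun θ : ℝ => vθ h s θ :=
    slice1 (f := vθ h) hvc s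
  have i3 : Continuous fun θ : ℝ => Complex.I * vθ h s θ := continuous_const.mul i2
  rw [intervalIntegral.integral_sub (i1.intervalIntegrable _ _)
    (i3.intervalIntegrable _ _), intervalIntegral.integral_const_mul,
    intervalIntegral.integral_eq_sub_of_hasDerivAt (fun θ _ => v_theta hd s θ)
      (i2.intervalIntegrable _ _)]
  have : v h s Real.pi = v h s (-Real.pi) := by
    have e1 := E_per s (-Real.pi)
    have e2 := E_per 1 (-Real.pi)
    rw [show -Real.pi + 2 * Real.pi = Real.pi by ring] at e1 e2
    simp [v, e1, e2]
  rw [this, sub_self, mul_zero, sub_zero, intervalIntegral.integral_ofReal,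
    ← intervalIntegral.integral_const_mul]
  simp only [mul_assoc]

lemma jensen (hd : Differentiable ℂ h) {r : ℝ} (hr : 0 < r) :
    (∫ θ in (-Real.pi)..Real.pi, Real.log (1 + ‖h (E r θ)‖ ^ 2)) -
      2 * Real.pi * Real.log (1 + ‖h 0‖ ^ 2) =
    ∫ ρ in (0:ℝ)..r, (4 * ∫ z in Metric.ball (0:ℂ) ρ, F h z) / ρ := by
  have hvc := v_cont hd
  have hc : Continuous (fun p : ℝ × ℝ => 2 * (v h p.1 p.2).re) :=
    continuous_const.mul (Complex.continuous_re.comp hvc)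
  have hx : ∀ θ : ℝ, Real.log (1 + ‖h (E r θ)‖ ^ 2) - Real.log (1 + ‖h 0‖ ^ 2) =
      ∫ s in (0:ℝ)..r, 2 * (v h s θ).re := by
    intro θ
    have hder : ∀ s : ℝ, HasDerivAt (fun s => Real.log (1 + ‖h (E s θ)‖ ^ 2))
      (2 * (v h s θ).re) s := fun s => u_deriv hd (E_rho s θ)
    rw [intervalIntegral.integral_eq_sub_of_hasDerivAt (fun s _ => hder s)]
    · simp [E]
    · exact (slice2 (f := fun s θ => 2 * (v h s θ).re) hc θ).intervalIntegrable _ _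
  have hu : Continuous fun θ : ℝ => Real.log (1 + ‖h (E r θ)‖ ^ 2) := by
    have : Continuous fun θ : ℝ => h (E r θ) := hd.continuous.comp (slice1 (f := E) E_cont r)
    refine Continuous.log (continuous_const.add (this.norm.pow 2)) (fun θ => by positivity)
  have : (∫ θ in (-Real.pi)..Real.pi, Real.log (1 + ‖h (E r θ)‖ ^ 2)) -
      2 * Real.pi * Real.log (1 + ‖h 0‖ ^ 2) = ∫ θ in (-Real.pi)..Real.pi,
        (Real.log (1 + ‖h (E r θ)‖ ^ 2) - Real.log (1 + ‖h 0‖ ^ 2)) := by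
    rw [intervalIntegral.integral_sub (hu.intervalIntegrable _ _) (by simp)]
    rw [intervalIntegral.integral_const, smul_eq_mul]
    ring
  rw [this]
  simp_rw [hx]
  rw [← swap (f := fun s θ => 2 * (v h s θ).re) hc]
  refine intervalIntegral.integral_congr_ae (Filter.Eventually.of_forall fun ρ hρ => ?_)
  rw [Set.uIoc_of_le hr.le] at hρ
  have h0 := hρ.1
  have ha := congrArg Complex.re (area hd h0.le)
  have i2 : Continuous fun θ : ℝ => v h ρ θ :=
    slice1 (f := v h) hvc ρ
  rw [Complex.re_ofReal_mul, Complex.ofReal_re] at ha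
  have hre : (∫ θ in (-Real.pi)..Real.pi, v h ρ θ).re =
      ∫ θ in (-Real.pi)..Real.pi, (v h ρ θ).re :=
    (Complex.reCLM.intervalIntegral_comp_comm (i2.intervalIntegrable _ _)).symm
  rw [intervalIntegral.integral_const_mul, ← hre, eq_div_iff h0.ne']
  linarith

end ASAux

/-- The Ahlfors–Shimizu (spherical) characteristic of a nowhere vanishing
entire function `h`, expressed via the Jensen identity in terms of the circle
means of `log (‖h‖ + ‖h‖⁻¹)`. -/
theorem ahlfors_shimizu_characteristic_eq
    (h : ℂ → ℂ) (hdiff : Differentiable ℂ h) (hnz : ∀ z : ℂ, h z ≠ 0)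
    (r : ℝ) (hr : 0 < r) :
    (∫ ρ in (0:ℝ)..r,
        ((2 / Real.pi) *
          ∫ z in Metric.ball (0:ℂ) ρ, ‖deriv h z‖ ^ 2 / (1 + ‖h z‖ ^ 2) ^ 2 ∂volume) / ρ) =
      (1 / (2 * Real.pi)) * (∫ θ in (0:ℝ)..(2 * Real.pi),
        Real.log (‖h ((r : ℂ) * Complex.exp ((θ : ℂ) * Complex.I))‖ +
          ‖h ((r : ℂ) * Complex.exp ((θ : ℂ) * Complex.I))‖⁻¹)) +
      Real.log ‖h 0‖ - Real.log (1 + ‖h 0‖ ^ 2) := by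
  have hpi := Real.pi_pos
  have hj := ASAux.jensen hdiff hr
  have hE : Continuous fun θ : ℝ => h (ASAux.E r θ) :=
    hdiff.continuous.comp (ASAux.slice1 (f := ASAux.E) ASAux.E_cont r)
  have hu : Continuous fun θ : ℝ => Real.log (1 + ‖h (ASAux.E r θ)‖ ^ 2) :=
    Continuous.log (continuous_const.add (hE.norm.pow 2)) (fun θ => by positivity)
  have hl : Continuous fun θ : ℝ => Real.log ‖h (ASAux.E r θ)‖ :=
    Continuous.log hE.norm (fun θ => by simpa using hnz _)
  have hper : Function.Periodic (fun θ : ℝ => Real.log (1 + ‖h (ASAux.E r θ)‖ ^ 2))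
      (2 * Real.pi) := fun θ => by simp only [ASAux.E_per]
  have hp := hper.intervalIntegral_add_eq (-Real.pi) 0
  rw [show -Real.pi + 2 * Real.pi = Real.pi by ring, zero_add] at hp
  have hm : Real.circleAverage (fun z => Real.log ‖h z‖) 0 r = Real.log ‖h 0‖ :=
    InnerProductSpace.HarmonicOnNhd.circleAverage_eq
      (fun z _ => (hdiff.analyticAt z).harmonicAt_log_norm (hnz z))
  rw [Real.circleAverage_def] at hm
  simp only [circleMap, zero_add, smul_eq_mul] at hm
  have hs : (∫ θ in (0:ℝ)..(2 * Real.pi),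
        Real.log (‖h ((r : ℂ) * Complex.exp ((θ : ℂ) * Complex.I))‖ +
          ‖h ((r : ℂ) * Complex.exp ((θ : ℂ) * Complex.I))‖⁻¹)) =
      (∫ θ in (0:ℝ)..(2 * Real.pi), Real.log (1 + ‖h (ASAux.E r θ)‖ ^ 2)) -
        ∫ θ in (0:ℝ)..(2 * Real.pi), Real.log ‖h (ASAux.E r θ)‖ := by
    rw [← intervalIntegral.integral_sub (hu.intervalIntegrable _ _) (hl.intervalIntegrable _ _)]
    congr 1
    ext θ
    have : 0 < ‖h (ASAux.E r θ)‖ := by simpa using hnz _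
    rw [← Real.log_div (by positivity) this.ne']
    congr 1
    change ‖h (ASAux.E r θ)‖ + ‖h (ASAux.E r θ)‖⁻¹ = _
    field_simp
    ring
  have hL : (∫ ρ in (0:ℝ)..r,
        ((2 / Real.pi) *
          ∫ z in Metric.ball (0:ℂ) ρ, ‖deriv h z‖ ^ 2 / (1 + ‖h z‖ ^ 2) ^ 2 ∂volume) / ρ) =
      (1 / (2 * Real.pi)) *
        ∫ ρ in (0:ℝ)..r, (4 * ∫ z in Metric.ball (0:ℂ) ρ, ASAux.F h z) / ρ := by
    rw [← intervalIntegral.integral_const_mul]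
    congr 1
    ext ρ
    unfold ASAux.F
    field_simp
    ring
  change (2 * Real.pi)⁻¹ * (∫ θ in (0:ℝ)..(2 * Real.pi), Real.log ‖h (ASAux.E r θ)‖) = _ at hm
  rw [hL, hs, ← hj, hp, ← hm]
  generalize (∫ θ in (0:ℝ)..(2 * Real.pi), Real.log ‖h (ASAux.E r θ)‖) = x
  generalize (∫ θ in (0:ℝ)..(2 * Real.pi), Real.log (1 + ‖h (ASAux.E r θ)‖ ^ 2)) = y
  field_simp
  ring
end

section
/- Let h : ℂ → ℂ be entire and nowhere vanishing, and suppose there exist a constant C > 0 and a natural number d such that for all r ≥ 1, ∫ ρ in (0)..(r), ((2/π) * ∫ z in Metric.ball (0:ℂ) ρ, ‖deriv h z‖^2 / (1 + ‖h z‖^2)^2 ∂(volume)) / ρ dρ ≤ C * r^d. Then there exists a polynomial P ∈ ℂ[X] with natural degree at most d such that h z = Complex.exp (P.eval z) for all z ∈ ℂ. -/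
open MeasureTheory

lemma aux_log (h : ℂ → ℂ) (hdiff : Differentiable ℂ h) (hnz : ∀ z : ℂ, h z ≠ 0) :
    ∃ g : ℂ → ℂ, Differentiable ℂ g ∧ ∀ z, h z = Complex.exp (g z) := by
  have hd : Differentiable ℂ (fun z => deriv h z / h z) :=
    (hdiff.deriv).div hdiff hnz
  obtain ⟨g, hg0, hg⟩ := hd.isExactOn_univ.with_val_at 0 (Complex.log (h 0))
  have hg' : ∀ z, HasDerivAt g (deriv h z / h z) z := fun z => hg z (Set.mem_univ _)
  refine ⟨g, fun z => (hg' z).differentiableAt, fun z => ?_⟩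
  have hF : ∀ z, HasDerivAt (fun z => h z * Complex.exp (-g z)) 0 z := by
    intro z
    refine ((hdiff z).hasDerivAt.mul ((hg' z).neg.cexp)).congr_deriv ?_
    have := hnz z
    simp only [Pi.neg_apply]
    field_simp
    ring
  have hc := is_const_of_deriv_eq_zero (fun z => (hF z).differentiableAt)
    (fun z => (hF z).deriv) z 0
  simp only [hg0, Complex.exp_neg, Complex.exp_log (hnz 0), mul_inv_cancel₀ (hnz 0)] at hc
  have := Complex.exp_ne_zero (g z)
  field_simp at hc
  exact hc

lemma aux_swap (F : ℝ → ℝ → ℝ) (hF : Continuous (fun p : ℝ × ℝ => F p.1 p.2)) (a b c d : ℝ) :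
    ∫ x in a..b, ∫ y in c..d, F x y = ∫ y in c..d, ∫ x in a..b, F x y := by
  apply intervalIntegral_intervalIntegral_swap
  have : IntegrableOn F.uncurry (Set.uIcc a b ×ˢ Set.uIcc c d) :=
    (hF.continuousOn).integrableOn_compact (isCompact_uIcc.prod isCompact_uIcc)
  exact this.mono_set (Set.prod_mono Set.uIoc_subset_uIcc Set.uIoc_subset_uIcc)

lemma aux_polar (f : ℂ → ℝ) (hf : Continuous f) (ρ : ℝ) (hρ : 0 ≤ ρ) :
    ∫ z in Metric.ball (0:ℂ) ρ, f z =
      ∫ s in (0:ℝ)..ρ, ∫ θ in (-Real.pi)..Real.pi, s * f (s * Complex.exp (θ * Complex.I)) := by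
  have hE : ∀ p : ℝ × ℝ, Complex.polarCoord.symm p = p.1 * Complex.exp (p.2 * Complex.I) := by
    intro p
    rw [Complex.polarCoord_symm_apply, Complex.exp_mul_I, Complex.ofReal_cos, Complex.ofReal_sin]
  rw [← integral_indicator Metric.isOpen_ball.measurableSet,
    ← Complex.integral_comp_polarCoord_symm]
  have h1 : ∀ p ∈ polarCoord.target,
      p.1 • (Metric.ball (0:ℂ) ρ).indicator f (Complex.polarCoord.symm p) =
      (Set.Ioo 0 ρ ×ˢ Set.univ).indicator
        (fun p : ℝ × ℝ => p.1 * f (p.1 * Complex.exp (p.2 * Complex.I))) p := by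
    rintro ⟨s, θ⟩ hp
    simp only [polarCoord_target, Set.mem_prod, Set.mem_Ioi] at hp
    rw [hE]
    by_cases hs : s < ρ
    · rw [Set.indicator_of_mem, Set.indicator_of_mem]
      · simp
      · simp [hp.1, hs]
      · simp [Complex.norm_exp_ofReal_mul_I, abs_of_pos hp.1, hs]
    · rw [Set.indicator_of_notMem, Set.indicator_of_notMem]
      · simp
      · simp [hs]
      · simpa [Complex.norm_exp_ofReal_mul_I, abs_of_pos hp.1] using hs
  rw [setIntegral_congr_fun polarCoord.open_target.measurableSet h1,
    setIntegral_indicator (measurableSet_Ioo.prod MeasurableSet.univ)]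
  have h2 : polarCoord.target ∩ Set.Ioo 0 ρ ×ˢ Set.univ =
      Set.Ioo 0 ρ ×ˢ Set.Ioo (-Real.pi) Real.pi := by
    ext ⟨s, θ⟩
    simp only [polarCoord_target, Set.mem_inter_iff, Set.mem_prod, Set.mem_Ioi, Set.mem_Ioo,
      Set.mem_univ]
    tauto
  rw [h2, Measure.volume_eq_prod, setIntegral_prod, intervalIntegral.integral_of_le hρ,
    integral_Ioc_eq_integral_Ioo]
  · congr 1
    ext s
    rw [intervalIntegral.integral_of_le (by linarith [Real.pi_pos]),
      integral_Ioc_eq_integral_Ioo]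
  · rw [← Measure.volume_eq_prod]
    have : IntegrableOn (fun p : ℝ × ℝ => p.1 * f (p.1 * Complex.exp (p.2 * Complex.I)))
        (Set.Icc 0 ρ ×ˢ Set.Icc (-Real.pi) Real.pi) :=
      (Continuous.continuousOn (by fun_prop)).integrableOn_compact
        (isCompact_Icc.prod isCompact_Icc)
    exact this.mono_set (Set.prod_mono Set.Ioo_subset_Icc_self Set.Ioo_subset_Icc_self)

/-- phi -/
noncomputable def phi0 (x : ℝ) : ℝ := Real.log (1 + Real.exp (2 * x))
noncomputable def phi1 (x : ℝ) : ℝ := 2 * Real.exp (2 * x) / (1 + Real.exp (2 * x))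
noncomputable def phi2 (x : ℝ) : ℝ := 4 * Real.exp (2 * x) / (1 + Real.exp (2 * x)) ^ 2

lemma aux_ne (x : ℝ) : 1 + Real.exp (2 * x) ≠ 0 := by positivity

lemma phi0_deriv (x : ℝ) : HasDerivAt phi0 (phi1 x) x := by
  have h1 : HasDerivAt (fun x : ℝ => 1 + Real.exp (2 * x)) (Real.exp (2 * x) * (2 * 1)) x :=
    (((hasDerivAt_id x).const_mul 2).exp).const_add 1
  refine (h1.log (aux_ne x)).congr_deriv ?_
  unfold phi1; ring

lemma phi1_deriv (x : ℝ) : HasDerivAt phi1 (phi2 x) x := by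
  have h0 : HasDerivAt (fun x : ℝ => Real.exp (2 * x)) (Real.exp (2 * x) * (2 * 1)) x :=
    ((hasDerivAt_id x).const_mul 2).exp
  have := aux_ne x
  refine ((h0.const_mul 2).div (h0.const_add 1) (aux_ne x)).congr_deriv ?_
  unfold phi2; field_simp; ring

@[fun_prop] lemma phi0_cont : Continuous phi0 :=
  continuous_iff_continuousAt.2 fun x => (phi0_deriv x).continuousAt
@[fun_prop] lemma phi1_cont : Continuous phi1 :=
  continuous_iff_continuousAt.2 fun x => (phi1_deriv x).continuousAt
@[fun_prop] lemma phi2_cont : Continuous phi2 := by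
  unfold phi2
  exact Continuous.div (by fun_prop) (by fun_prop) (fun x => pow_ne_zero 2 (aux_ne x))

/-- real part along a real curve -/
lemma aux_re (k : ℂ → ℂ) (k' : ℂ) (c : ℝ → ℂ) (c' : ℂ) (t : ℝ) (hk : HasDerivAt k k' (c t))
    (hc : HasDerivAt c c' t) : HasDerivAt (fun t => (k (c t)).re) (k' * c').re t := by
  have h1 : HasDerivAt (fun t => k (c t)) (k' * c') t := by
    exact (HasDerivAt.scomp_of_eq (𝕜 := ℝ) t hk hc rfl).congr_deriv (by simp [mul_comm])
  exact Complex.reCLM.hasFDerivAt.comp_hasDerivAt t h1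

lemma aux_im (k : ℂ → ℂ) (k' : ℂ) (c : ℝ → ℂ) (c' : ℂ) (t : ℝ) (hk : HasDerivAt k k' (c t))
    (hc : HasDerivAt c c' t) : HasDerivAt (fun t => (k (c t)).im) (k' * c').im t := by
  have h1 : HasDerivAt (fun t => k (c t)) (k' * c') t := by
    exact (HasDerivAt.scomp_of_eq (𝕜 := ℝ) t hk hc rfl).congr_deriv (by simp [mul_comm])
  exact Complex.imCLM.hasFDerivAt.comp_hasDerivAt t h1

lemma aux_crad (θ ρ : ℝ) : HasDerivAt (fun ρ : ℝ => (ρ : ℂ) * Complex.exp (θ * Complex.I))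
    (Complex.exp (θ * Complex.I)) ρ := by
  simpa using (Complex.ofRealCLM.hasDerivAt (x := ρ)).mul_const (Complex.exp (θ * Complex.I))

lemma aux_cexp (θ : ℝ) : HasDerivAt (fun θ : ℝ => Complex.exp (θ * Complex.I))
    (Complex.exp (θ * Complex.I) * Complex.I) θ := by
  have := ((Complex.ofRealCLM.hasDerivAt (x := θ)).mul_const Complex.I).cexp
  simpa using this

lemma aux_cang (ρ θ : ℝ) : HasDerivAt (fun θ : ℝ => (ρ : ℂ) * Complex.exp (θ * Complex.I))
    (ρ * (Complex.exp (θ * Complex.I) * Complex.I)) θ :=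
  (aux_cexp θ).const_mul _

section
variable (g : ℂ → ℂ) (hg : Differentiable ℂ g)
include hg

lemma aux_B_deriv (θ ρ : ℝ) : HasDerivAt
    (fun ρ : ℝ => phi1 (g (ρ * Complex.exp (θ * Complex.I))).re *
      ((fun z => z * deriv g z) (ρ * Complex.exp (θ * Complex.I))).re)
    (phi2 (g (ρ * Complex.exp (θ * Complex.I))).re *
      (deriv g (ρ * Complex.exp (θ * Complex.I)) * Complex.exp (θ * Complex.I)).re *
      ((ρ * Complex.exp (θ * Complex.I)) * deriv g (ρ * Complex.exp (θ * Complex.I))).re +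
     phi1 (g (ρ * Complex.exp (θ * Complex.I))).re *
      ((1 * deriv g (ρ * Complex.exp (θ * Complex.I)) + (ρ * Complex.exp (θ * Complex.I)) *
        deriv (deriv g) (ρ * Complex.exp (θ * Complex.I))) * Complex.exp (θ * Complex.I)).re) ρ := by
  have h1 := (phi1_deriv _).comp ρ (aux_re g _ _ _ ρ (hg _).hasDerivAt (aux_crad θ ρ))
  have h2 := aux_re (fun z => z * deriv g z) _ _ _ ρ
    ((hasDerivAt_id _).mul (hg.deriv _).hasDerivAt) (aux_crad θ ρ)
  exact h1.mul h2

/-- derivative of Y = phi1 * Im (E g'(ρE)) in θ -/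
lemma aux_Y_deriv (ρ θ : ℝ) : HasDerivAt
    (fun θ : ℝ => phi1 (g (ρ * Complex.exp (θ * Complex.I))).re *
      (Complex.exp (θ * Complex.I) * deriv g (ρ * Complex.exp (θ * Complex.I))).im)
    (phi2 (g (ρ * Complex.exp (θ * Complex.I))).re *
      (deriv g (ρ * Complex.exp (θ * Complex.I)) *
        (ρ * (Complex.exp (θ * Complex.I) * Complex.I))).re *
      (Complex.exp (θ * Complex.I) * deriv g (ρ * Complex.exp (θ * Complex.I))).im +
     phi1 (g (ρ * Complex.exp (θ * Complex.I))).re *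
      ((1 * deriv g (ρ * Complex.exp (θ * Complex.I)) + (Complex.exp (θ * Complex.I)) *
        (deriv (deriv g) (ρ * Complex.exp (θ * Complex.I)) * (ρ * 1))) *
          (Complex.exp (θ * Complex.I) * Complex.I)).im) θ := by
  have h1 := (phi1_deriv _).comp θ (aux_re g _ _ _ θ (hg _).hasDerivAt (aux_cang ρ θ))
  have h2 := aux_im (fun z => z * deriv g (ρ * z)) _ _ _ θ
    ((hasDerivAt_id _).mul (HasDerivAt.comp (h₂ := deriv g) _ (hg.deriv _).hasDerivAt
      ((hasDerivAt_id _).const_mul (ρ:ℂ)))) (aux_cexp θ)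
  exact h1.mul h2

lemma aux_B (ρ : ℝ) :
    ∫ θ in (-Real.pi)..Real.pi, phi1 (g (ρ * Complex.exp (θ * Complex.I))).re *
      ((ρ * Complex.exp (θ * Complex.I)) * deriv g (ρ * Complex.exp (θ * Complex.I))).re =
    ∫ s in (0:ℝ)..ρ, ∫ θ in (-Real.pi)..Real.pi, s *
      (phi2 (g (s * Complex.exp (θ * Complex.I))).re *
        ‖deriv g (s * Complex.exp (θ * Complex.I))‖ ^ 2) := by
  have c0 := hg.continuous
  have c1 : Continuous (deriv g) := hg.deriv.continuous
  have c2 : Continuous (deriv (deriv g)) := hg.deriv.deriv.continuous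
  have hY0 : ∀ s : ℝ, ∫ θ in (-Real.pi)..Real.pi, _ = _ := fun s =>
    intervalIntegral.integral_eq_sub_of_hasDerivAt (a := -Real.pi) (b := Real.pi)
      (fun θ _ => aux_Y_deriv g hg s θ)
      (Continuous.intervalIntegrable (by fun_prop) _ _)
  have hB0 : ∀ θ : ℝ, ∫ s in (0:ℝ)..ρ, _ = _ := fun θ =>
    intervalIntegral.integral_eq_sub_of_hasDerivAt (a := 0) (b := ρ)
      (fun s _ => aux_B_deriv g hg θ s)
      (Continuous.intervalIntegrable (by fun_prop) _ _)
  simp only [Complex.ofReal_zero, zero_mul, Complex.zero_re, mul_zero, sub_zero] at hB0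
  simp only [← hB0]
  rw [← aux_swap _ (by fun_prop)]
  apply intervalIntegral.integral_congr
  intro s _
  have hY1 := hY0 s
  have e1 : Complex.exp (((-Real.pi : ℝ) : ℂ) * Complex.I) = -1 := by
    push_cast; rw [neg_mul, Complex.exp_neg, Complex.exp_pi_mul_I]; norm_num
  rw [e1, Complex.exp_pi_mul_I, sub_self] at hY1
  dsimp only
  rw [← sub_eq_zero, ← intervalIntegral.integral_sub
    (Continuous.intervalIntegrable (by fun_prop) _ _)
    (Continuous.intervalIntegrable (by fun_prop) _ _), ← hY1]
  apply intervalIntegral.integral_congr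
  intro θ _
  dsimp only
  have hn : ‖deriv g (s * Complex.exp (θ * Complex.I))‖ ^ 2 =
      (deriv g (s * Complex.exp (θ * Complex.I)) * Complex.exp (θ * Complex.I)).re ^ 2 +
      (deriv g (s * Complex.exp (θ * Complex.I)) * Complex.exp (θ * Complex.I)).im ^ 2 := by
    have : ‖deriv g (s * Complex.exp (θ * Complex.I))‖ =
        ‖deriv g (s * Complex.exp (θ * Complex.I)) * Complex.exp (θ * Complex.I)‖ := by
      rw [norm_mul, Complex.norm_exp_ofReal_mul_I, mul_one]
    rw [this, Complex.sq_norm, Complex.normSq_apply]; ring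
  rw [hn]
  generalize deriv g (s * Complex.exp (θ * Complex.I)) = u at *
  generalize deriv (deriv g) (s * Complex.exp (θ * Complex.I)) = v at *
  generalize Complex.exp (θ * Complex.I) = E at *
  simp only [Complex.mul_re, Complex.mul_im, Complex.add_re, Complex.add_im, Complex.ofReal_re,
    Complex.ofReal_im, Complex.I_re, Complex.I_im, Complex.one_re, Complex.one_im]
  ring

lemma aux_A (r : ℝ) :
    (∫ θ in (-Real.pi)..Real.pi, phi0 (g (r * Complex.exp (θ * Complex.I))).re)
      - 2 * Real.pi * phi0 (g 0).re =
    ∫ s in (0:ℝ)..r, ∫ θ in (-Real.pi)..Real.pi, phi1 (g (s * Complex.exp (θ * Complex.I))).re *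
        (deriv g (s * Complex.exp (θ * Complex.I)) * Complex.exp (θ * Complex.I)).re := by
  have c0 := hg.continuous
  have c1 : Continuous (deriv g) := hg.deriv.continuous
  have hB0 : ∀ θ : ℝ, ∫ s in (0:ℝ)..r, _ = _ := fun θ =>
    intervalIntegral.integral_eq_sub_of_hasDerivAt (a := 0) (b := r)
      (fun s _ => (phi0_deriv _).comp s (aux_re g _ _ _ s (hg _).hasDerivAt (aux_crad θ s)))
      (Continuous.intervalIntegrable (by fun_prop) _ _)
  rw [aux_swap _ (by fun_prop)]
  simp only [hB0, Function.comp_def]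
  rw [intervalIntegral.integral_sub
    (Continuous.intervalIntegrable (by fun_prop) _ _)
    (Continuous.intervalIntegrable (by fun_prop) _ _)]
  simp only [Complex.ofReal_zero, zero_mul, intervalIntegral.integral_const, smul_eq_mul]
  ring

lemma aux_main (r : ℝ) (hr : 0 ≤ r) :
    (∫ θ in (-Real.pi)..Real.pi, phi0 (g (r * Complex.exp (θ * Complex.I))).re)
      - 2 * Real.pi * phi0 (g 0).re =
    2 * Real.pi * ∫ ρ in (0:ℝ)..r,
        ((2 / Real.pi) *
          ∫ z in Metric.ball (0:ℂ) ρ, ‖deriv (fun z => Complex.exp (g z)) z‖ ^ 2 /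
            (1 + ‖Complex.exp (g z)‖ ^ 2) ^ 2 ∂volume) / ρ := by
  have c0 := hg.continuous
  have c1 : Continuous (deriv g) := hg.deriv.continuous
  rw [aux_A g hg, ← intervalIntegral.integral_const_mul]
  apply intervalIntegral.integral_congr_ae
  refine Filter.Eventually.of_forall fun ρ hρ => ?_
  rw [Set.uIoc_of_le hr] at hρ
  have hρ0 := hρ.1
  have e : ∀ z, ‖deriv (fun z => Complex.exp (g z)) z‖ ^ 2 /
            (1 + ‖Complex.exp (g z)‖ ^ 2) ^ 2 = (1 / 4) * (phi2 (g z).re * ‖deriv g z‖ ^ 2) := by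
    intro z
    have h1 : deriv (fun z => Complex.exp (g z)) z = Complex.exp (g z) * deriv g z :=
      ((hg z).hasDerivAt.cexp).deriv
    rw [h1, norm_mul, Complex.norm_exp, phi2]
    have h2 : Real.exp (2 * (g z).re) = Real.exp (g z).re ^ 2 := by
      rw [← Real.exp_nat_mul]; norm_num
    rw [h2]
    ring
  simp only [e]
  rw [integral_const_mul, aux_polar _ (by fun_prop) ρ hρ0.le, ← aux_B g hg]
  have e2 : ∀ θ : ℝ, phi1 (g (ρ * Complex.exp (θ * Complex.I))).re *
      ((ρ * Complex.exp (θ * Complex.I)) * deriv g (ρ * Complex.exp (θ * Complex.I))).re =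
      ρ * (phi1 (g (ρ * Complex.exp (θ * Complex.I))).re *
      (deriv g (ρ * Complex.exp (θ * Complex.I)) * Complex.exp (θ * Complex.I)).re) := by
    intro θ
    rw [mul_assoc, Complex.re_ofReal_mul, mul_comm (Complex.exp _)]; ring
  simp only [e2]
  rw [intervalIntegral.integral_const_mul]
  have := Real.pi_pos
  generalize (∫ θ in (-Real.pi)..Real.pi, (phi1 (g (ρ * Complex.exp (θ * Complex.I))).re *
      (deriv g (ρ * Complex.exp (θ * Complex.I)) * Complex.exp (θ * Complex.I)).re)) = J
  field_simp
  ring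

end

lemma phi0_ge (x : ℝ) : |x| ≤ phi0 x - x := by
  unfold phi0
  have h1 : 2 * x ≤ Real.log (1 + Real.exp (2 * x)) := by
    rw [Real.le_log_iff_exp_le (by positivity)]; linarith
  have h2 : 0 ≤ Real.log (1 + Real.exp (2 * x)) :=
    Real.log_nonneg (by linarith [Real.exp_pos (2 * x)])
  rw [abs_le]
  constructor <;> linarith

lemma aux_avg (f : ℂ → ℝ) (r : ℝ) : Real.circleAverage f 0 r =
    (2 * Real.pi)⁻¹ * ∫ θ in (-Real.pi)..Real.pi, f (r * Complex.exp (θ * Complex.I)) := by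
  have hp : Function.Periodic (fun θ : ℝ => f (circleMap 0 r θ)) (2 * Real.pi) := fun x => by
    simp [periodic_circleMap 0 r x]
  have := hp.intervalIntegral_add_eq 0 (-Real.pi)
  rw [Real.circleAverage_def, smul_eq_mul]
  rw [zero_add, show -Real.pi + 2 * Real.pi = Real.pi by ring] at this
  rw [this]
  simp [circleMap]

lemma aux_coeff (g : ℂ → ℂ) (hg : Differentiable ℂ g) (n : ℕ) (hn : n ≠ 0) (r : ℝ) (hr : 0 < r) :
    ‖iteratedDeriv n g 0‖ / n.factorial * r ^ n ≤
      2 * Real.circleAverage (fun z => |(g z).re|) 0 r := by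
  have c0 := hg.continuous
  have h1 := (hg.differentiableOn (s := Metric.closedBall 0 r)).circleIntegral_one_div_sub_center_pow_smul hr n
  have h2 : ∮ z in C(0, r), z ^ (n - 1) * g z = 0 :=
    DiffContOnCl.circleIntegral_eq_zero hr.le (Differentiable.diffContOnCl (by fun_prop))
  simp only [circleIntegral, deriv_circleMap, sub_zero, smul_eq_mul] at h1 h2
  set E : ℝ → ℂ := fun θ => Complex.exp (θ * Complex.I) with hE
  have hE0 : ∀ θ, E θ ≠ 0 := fun θ => Complex.exp_ne_zero _
  have hEc : ∀ θ, (starRingEnd ℂ) (E θ) = (E θ)⁻¹ := fun θ => by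
    simp only [hE, ← Complex.exp_conj, ← Complex.exp_neg]; simp
  have hEcont : Continuous E := by fun_prop
  have hm : ∀ θ, circleMap 0 r θ = r * E θ := fun θ => by simp [circleMap, hE]
  simp only [hm] at h1 h2
  have hr' : (r : ℂ) ≠ 0 := by exact_mod_cast hr.ne'
  have k1 : ∫ θ in (0:ℝ)..2 * Real.pi, (E θ)⁻¹ ^ n * g (r * E θ) =
      r ^ n * (2 * Real.pi / n.factorial * iteratedDeriv n g 0) := by
    have : ∀ θ, r * E θ * Complex.I * (1 / (r * E θ) ^ (n + 1) * g (r * E θ)) =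
        (Complex.I / r ^ n) * ((E θ)⁻¹ ^ n * g (r * E θ)) := by
      intro θ
      have := hE0 θ
      rw [inv_pow, mul_pow]
      field_simp
      ring
    simp only [this] at h1
    rw [intervalIntegral.integral_const_mul] at h1
    have hI := Complex.I_ne_zero
    have hf : (n.factorial : ℂ) ≠ 0 := by exact_mod_cast n.factorial_ne_zero
    generalize (∫ θ in (0:ℝ)..2 * Real.pi, (E θ)⁻¹ ^ n * g (r * E θ)) = J at *
    field_simp at h1 ⊢
    linear_combination h1
  have k2 : ∫ θ in (0:ℝ)..2 * Real.pi, (E θ) ^ n * g (r * E θ) = 0 := by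
    have : ∀ θ, r * E θ * Complex.I * ((r * E θ) ^ (n - 1) * g (r * E θ)) =
        (Complex.I * r ^ n) * ((E θ) ^ n * g (r * E θ)) := by
      intro θ
      obtain ⟨m, rfl⟩ := Nat.exists_eq_succ_of_ne_zero hn
      simp only [Nat.succ_eq_add_one, Nat.add_sub_cancel]
      ring
    simp only [this] at h2
    rw [intervalIntegral.integral_const_mul] at h2
    simpa [hr'] using h2
  have k3 : ∫ θ in (0:ℝ)..2 * Real.pi, (E θ)⁻¹ ^ n * (starRingEnd ℂ) (g (r * E θ)) = 0 := by
    have := congrArg (starRingEnd ℂ) k2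
    rw [intervalIntegral.integral_of_le Real.two_pi_pos.le, ← integral_conj,
      ← intervalIntegral.integral_of_le Real.two_pi_pos.le] at this
    simpa [hEc] using this
  have hinv : Continuous fun θ => (E θ)⁻¹ := hEcont.inv₀ hE0
  have k4 : ∫ θ in (0:ℝ)..2 * Real.pi, (E θ)⁻¹ ^ n * (2 * ((g (r * E θ)).re : ℂ)) =
      r ^ n * (2 * Real.pi / n.factorial * iteratedDeriv n g 0) := by
    rw [← k1, ← add_zero (∫ θ in (0:ℝ)..2 * Real.pi, (E θ)⁻¹ ^ n * g (r * E θ)), ← k3,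
      ← intervalIntegral.integral_add (Continuous.intervalIntegrable (by fun_prop) _ _)
        (Continuous.intervalIntegrable (by fun_prop) _ _)]
    congr 1
    ext θ
    rw [← mul_add, Complex.add_conj]
    push_cast; rfl
  have k5 := intervalIntegral.norm_integral_le_integral_norm (μ := volume)
    (f := fun θ => (E θ)⁻¹ ^ n * (2 * ((g (r * E θ)).re : ℂ))) Real.two_pi_pos.le
  have hEn : ∀ θ, ‖E θ‖ = 1 := fun θ => Complex.norm_exp_ofReal_mul_I θ
  rw [k4] at k5
  simp only [norm_mul, norm_pow, norm_inv, hEn, inv_one, one_pow, one_mul, norm_div,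
    Complex.norm_real, Complex.norm_natCast, Complex.norm_ofNat, Real.norm_eq_abs,
    abs_of_pos hr, abs_of_pos Real.pi_pos] at k5
  rw [intervalIntegral.integral_const_mul] at k5
  rw [Real.circleAverage_def, smul_eq_mul]
  simp only [hm]
  have hpi := Real.pi_pos
  have hf : (0:ℝ) < n.factorial := by exact_mod_cast n.factorial_pos
  generalize ∫ θ in (0:ℝ)..2 * Real.pi, |(g (r * E θ)).re| = J at *
  have : ‖iteratedDeriv n g 0‖ / n.factorial * r ^ n =
    (2 * Real.pi)⁻¹ * (r ^ n * (2 * Real.pi / n.factorial * ‖iteratedDeriv n g 0‖)) := by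
    field_simp
  rw [this]
  calc _ ≤ (2 * Real.pi)⁻¹ * (2 * J) := by gcongr
    _ = _ := by ring

lemma aux_poly (g : ℂ → ℂ) (hg : Differentiable ℂ g) (d : ℕ)
    (h0 : ∀ n, d < n → iteratedDeriv n g 0 = 0) :
    ∃ P : Polynomial ℂ, P.natDegree ≤ d ∧ ∀ z : ℂ, g z = P.eval z := by
  refine ⟨∑ n ∈ Finset.range (d + 1),
    Polynomial.monomial n ((n.factorial : ℂ)⁻¹ * iteratedDeriv n g 0), ?_, fun z => ?_⟩
  · apply Polynomial.natDegree_sum_le_of_forall_le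
    intro n hn
    exact (Polynomial.natDegree_monomial_le _).trans (by simp at hn; omega)
  · rw [← Complex.taylorSeries_eq_of_entire' 0 z hg, tsum_eq_sum (s := Finset.range (d + 1))]
    · simp [Polynomial.eval_finsetSum]
    · intro n hn
      rw [h0 n (by simp at hn; omega)]; simp

lemma aux_ci {F : Type*} [NormedAddCommGroup F] (f : ℂ → F) (hf : Continuous f) (r : ℝ) :
    CircleIntegrable f 0 r :=
  ContinuousOn.circleIntegrable' hf.continuousOn

lemma aux_bound (g : ℂ → ℂ) (hg : Differentiable ℂ g) (r : ℝ) :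
    Real.circleAverage (fun z => |(g z).re|) 0 r ≤
      Real.circleAverage (fun z => phi0 (g z).re) 0 r - (g 0).re := by
  have c0 := hg.continuous
  have i1 : CircleIntegrable (fun z => phi0 (g z).re) 0 r :=
    aux_ci _ (by fun_prop) r
  have i2 : CircleIntegrable (fun z => (g z).re) 0 r :=
    aux_ci _ (by fun_prop) r
  have hm : Real.circleAverage (fun z => (g z).re) 0 r = (g 0).re := by
    have h1 : Real.circleAverage g 0 r = g 0 := DiffContOnCl.circleAverage hg.diffContOnCl
    have h2 := Complex.reCLM.circleAverage_comp_comm (f := g) (c := 0) (R := r)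
      (aux_ci g c0 r)
    rw [h1] at h2
    exact h2
  rw [← hm, ← Real.circleAverage_fun_sub i1 i2]
  exact Real.circleAverage_mono (aux_ci _ (by fun_prop) r) (i1.sub i2)
    (fun z _ => phi0_ge _)

/-- A nowhere vanishing entire function whose Ahlfors–Shimizu characteristic
grows at most like `C * r ^ d` is the exponential of a polynomial of degree at
most `d`. -/
theorem nonvanishing_entire_poly_characteristic_is_exp_poly
    (h : ℂ → ℂ) (hdiff : Differentiable ℂ h) (hnz : ∀ z : ℂ, h z ≠ 0)
    (C : ℝ) (hC : 0 < C) (d : ℕ)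
    (hchar : ∀ r : ℝ, 1 ≤ r →
      (∫ ρ in (0:ℝ)..r,
        ((2 / Real.pi) *
          ∫ z in Metric.ball (0:ℂ) ρ, ‖deriv h z‖ ^ 2 / (1 + ‖h z‖ ^ 2) ^ 2 ∂volume) / ρ) ≤
        C * r ^ d) :
    ∃ P : Polynomial ℂ, P.natDegree ≤ d ∧ ∀ z : ℂ, h z = Complex.exp (P.eval z) := by
  obtain ⟨g, hg, hgh⟩ := aux_log h hdiff hnz
  obtain rfl : h = fun z => Complex.exp (g z) := funext hgh
  suffices h0 : ∀ n, d < n → iteratedDeriv n g 0 = 0 by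
    obtain ⟨P, hP, hPg⟩ := aux_poly g hg d h0
    exact ⟨P, hP, fun z => by rw [← hPg]⟩
  intro n hn
  set K : ℝ := |phi0 (g 0).re - (g 0).re| with hK
  have key : ∀ r : ℝ, 1 ≤ r →
      ‖iteratedDeriv n g 0‖ / n.factorial * r ≤ 2 * (C + K) := by
    intro r hr
    have hr0 : 0 < r := by linarith
    have h1 := aux_coeff g hg n (by omega) r hr0
    have h2 := aux_bound g hg r
    rw [aux_avg (fun z => phi0 (g z).re)] at h2
    have h3 := aux_main g hg r hr0.le
    have h4 := hchar r hr
    have hpi := Real.pi_pos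
    rw [sub_eq_iff_eq_add] at h3
    rw [h3, ← mul_add, inv_mul_cancel_left₀ (by positivity)] at h2
    have h5 : phi0 (g 0).re - (g 0).re ≤ K := le_abs_self _
    have h6 : (1:ℝ) ≤ r ^ d := one_le_pow₀ hr
    have h7 : K ≤ K * r ^ d := le_mul_of_one_le_right (abs_nonneg _) h6
    have h8 : r ^ d * r ≤ r ^ n := by
      rw [← pow_succ]; exact pow_le_pow_right₀ hr hn
    have h9 : ‖iteratedDeriv n g 0‖ / n.factorial * (r ^ d * r) ≤
        ‖iteratedDeriv n g 0‖ / n.factorial * r ^ n := by gcongr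
    have h10 : (‖iteratedDeriv n g 0‖ / n.factorial * r) * r ^ d ≤ (2 * (C + K)) * r ^ d := by
      nlinarith
    exact le_of_mul_le_mul_right h10 (by positivity)
  by_contra hne
  have hpos : 0 < ‖iteratedDeriv n g 0‖ / n.factorial := by
    have := norm_pos_iff.2 hne
    positivity
  set a := ‖iteratedDeriv n g 0‖ / n.factorial
  have hKn : 0 ≤ K := abs_nonneg _
  have := key (1 + 2 * (C + K) / a) (by
    have : 0 ≤ 2 * (C + K) / a := by positivity
    linarith)
  rw [mul_add, mul_div_cancel₀ _ hpos.ne'] at this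
  linarith
end

section
/- Let h : ℂ → ℂ be entire and nowhere vanishing. Then for every real r > 0, (1/(2*π)) * ∫ θ in (0)..(2*π), Real.log ‖h (r * Complex.exp (θ * Complex.I))‖ dθ = Real.log ‖h 0‖. -/
open Real

/-- Jensen's formula in the zero-free case: the circle means of `log ‖h‖` of a
nowhere vanishing entire function `h` all equal `log ‖h 0‖`. -/
theorem circle_mean_log_norm_eq
    (h : ℂ → ℂ) (hdiff : Differentiable ℂ h) (hnz : ∀ z : ℂ, h z ≠ 0)
    (r : ℝ) (hr : 0 < r) :
    (1 / (2 * Real.pi)) * (∫ θ in (0:ℝ)..(2 * Real.pi),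
        Real.log ‖h ((r : ℂ) * Complex.exp ((θ : ℂ) * Complex.I))‖) =
      Real.log ‖h 0‖ := by
  have key : circleAverage (fun z => Real.log ‖h z‖) 0 r = Real.log ‖h 0‖ := by
    rw [InnerProductSpace.HarmonicOnNhd.circleAverage_eq]
    intro x hx
    exact AnalyticAt.harmonicAt_log_norm (hdiff.analyticAt x) (hnz x)
  rw [← key]
  simp [circleAverage, circleMap]
end
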